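/- arXiv:2111.01638 — 2 statements merged into one kernel-verified Lean document; each statement's English description precedes it below -/
import Mathlib

section
/- Let G be a finite normal-form game with exactly N = 2 players. Then a mixed-strategy profile σ ∈ Σ is a perfect equilibrium of G if and only if there exists an LPS profile ϱ of order 1 over S such that: (1) ϱ has full support and ℓ(ϱ) ≤ 1; (2) ϱ_n^0 = σ_n for each player n; (3) σ_n is a best reply of order 1 against ϱ for each player n. -/
namespace GamePE

variable {N : ℕ}

/-- A (not necessarily mixed) strategy profile. -/
abbrev Profile (S : Fin N → Type) := ∀ n, S n → ℝ

/-- τ is a profile of mixed strategies. -/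
def IsMixed {S : Fin N → Type} [∀ n, Fintype (S n)] (τ : Profile S) : Prop :=
  ∀ n, (∀ s, 0 ≤ τ n s) ∧ (∑ s, τ n s) = 1

/-- τ is completely mixed. -/
def CompletelyMixed {S : Fin N → Type} (τ : Profile S) : Prop := ∀ n s, 0 < τ n s

/-- The pure strategy sn viewed as a mixed strategy. -/
def pureStrat {S : Fin N → Type} [∀ n, DecidableEq (S n)] {n : Fin N} (sn : S n) : S n → ℝ :=
  fun s => if s = sn then 1 else 0

/-- The multilinear extension of player n's payoff. -/
noncomputable def payoff {S : Fin N → Type} [∀ n, Fintype (S n)]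
    (G : Fin N → (∀ m, S m) → ℝ) (n : Fin N) (τ : Profile S) : ℝ :=
  ∑ s : ∀ m, S m, (∏ m, τ m (s m)) * G n s

/-- σ is a perfect equilibrium of the game G. -/
noncomputable def IsPerfect {S : Fin N → Type} [∀ n, Fintype (S n)] [∀ n, DecidableEq (S n)]
    (G : Fin N → (∀ m, S m) → ℝ) (σ : Profile S) : Prop :=
  ∃ σk : ℕ → Profile S,
    (∀ k, IsMixed (σk k) ∧ CompletelyMixed (σk k)) ∧
    Filter.Tendsto σk Filter.atTop (nhds σ) ∧
    (∀ (k : ℕ) (n : Fin N) (sn : S n),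
      payoff G n (Function.update (σk k) n (σ n)) ≥
        payoff G n (Function.update (σk k) n (pureStrat sn)))

/-- ϱ is an LPS profile of order K : each level of each player is a probability distribution. -/
def IsLPSProfile {S : Fin N → Type} [∀ n, Fintype (S n)] {K : ℕ}
    (ϱ : ∀ n, Fin (K+1) → S n → ℝ) : Prop :=
  ∀ n k, (∀ s, 0 ≤ ϱ n k s) ∧ (∑ s, ϱ n k s) = 1

/-- Full support for an LPS profile. -/
def FullSupport {S : Fin N → Type} {K : ℕ} (ϱ : ∀ n, Fin (K+1) → S n → ℝ) : Prop :=
  ∀ n, ∀ s : S n, ∃ k, ϱ n k s ≠ 0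

/-- ℓ(ϱ) : the max over the players of the first level at which the union of supports is everything. -/
noncomputable def lpsLevel {S : Fin N → Type} [∀ n, Fintype (S n)] {K : ℕ}
    (ϱ : ∀ n, Fin (K+1) → S n → ℝ) : ℕ :=
  Finset.univ.sup fun n =>
    sInf {k : ℕ | ∀ s : S n, ∃ i : Fin (K+1), (i : ℕ) ≤ k ∧ ϱ n i s ≠ 0}

/-- Combine a pure strategy of player n with a pure strategy profile of the others. -/
def combine {S : Fin N → Type} (n : Fin N) (sn : S n)
    (so : ∀ m : {m : Fin N // m ≠ n}, S m.val) : ∀ m, S m :=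
  fun m => if h : m = n then cast (congrArg S h.symm) sn else so ⟨m, h⟩

/-- Unnormalized induced beliefs of player n at level k. -/
noncomputable def ubelief {S : Fin N → Type} [∀ n, Fintype (S n)] {K : ℕ}
    (ϱ : ∀ n, Fin (K+1) → S n → ℝ) (n : Fin N) (k : ℕ)
    (so : ∀ m : {m : Fin N // m ≠ n}, S m.val) : ℝ :=
  ∑ kv ∈ Finset.univ.filter
      (fun kv : {m : Fin N // m ≠ n} → Fin (K+1) => (∑ m, ((kv m : ℕ))) = k),
    ∏ m : {m : Fin N // m ≠ n}, ϱ m.val (kv m) (so m)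

/-- Induced beliefs μ_n^k of player n at level k (normalized). -/
noncomputable def belief {S : Fin N → Type} [∀ n, Fintype (S n)] {K : ℕ}
    (ϱ : ∀ n, Fin (K+1) → S n → ℝ) (n : Fin N) (k : ℕ)
    (so : ∀ m : {m : Fin N // m ≠ n}, S m.val) : ℝ :=
  (∑ so' : ∀ m : {m : Fin N // m ≠ n}, S m.val, ubelief ϱ n k so')⁻¹ * ubelief ϱ n k so

/-- Expected payoff of player n playing τn against a belief μ over the opponents' profiles. -/
noncomputable def beliefPayoff {S : Fin N → Type} [∀ n, Fintype (S n)]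
    (G : Fin N → (∀ m, S m) → ℝ) (n : Fin N) (τn : S n → ℝ)
    (μ : (∀ m : {m : Fin N // m ≠ n}, S m.val) → ℝ) : ℝ :=
  ∑ so : ∀ m : {m : Fin N // m ≠ n}, S m.val, ∑ sn : S n,
    μ so * τn sn * G n (combine n sn so)

/-- Lexicographic comparison of the first k+1 entries (indices 0,…,k) of two sequences. -/
def lexGe (k : ℕ) (a b : ℕ → ℝ) : Prop :=
  (∀ i ≤ k, a i = b i) ∨ ∃ i ≤ k, (∀ j < i, a j = b j) ∧ b i < a i

/-- τn is a best reply of order k against the LPS profile ϱ. -/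
noncomputable def lpsBestReply {S : Fin N → Type} [∀ n, Fintype (S n)] [∀ n, DecidableEq (S n)]
    (G : Fin N → (∀ m, S m) → ℝ) {K : ℕ} (ϱ : ∀ n, Fin (K+1) → S n → ℝ)
    (n : Fin N) (τn : S n → ℝ) (k : ℕ) : Prop :=
  ∀ sn : S n,
    lexGe k (fun i => beliefPayoff G n τn (belief ϱ n i))
            (fun i => beliefPayoff G n (pureStrat sn) (belief ϱ n i))

/-- A polynomial strategy profile. -/
abbrev PolyProfile (S : Fin N → Type) := ∀ n, S n → Polynomial ℝ

/-- f > 0 for a univariate real polynomial: the trailing (lowest-order) coefficient is positive. -/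
def polyPos (f : Polynomial ℝ) : Prop := 0 < f.trailingCoeff

/-- f ≥ 0 : f is identically zero or its trailing coefficient is positive. -/
def polyNonneg (f : Polynomial ℝ) : Prop := f = 0 ∨ 0 < f.trailingCoeff

/-- The order o(η) of a polynomial strategy profile (∞ if some coordinate is zero). -/
noncomputable def polyOrder {S : Fin N → Type} [∀ n, Fintype (S n)]
    (η : PolyProfile S) : ℕ∞ :=
  Finset.univ.sup fun p : Σ n, S n => (η p.1 p.2).trailingDegree

/-- The polynomial t ↦ G_n(τn, η_{-n}(t)). -/
noncomputable def payoffPoly {S : Fin N → Type} [∀ n, Fintype (S n)]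
    (G : Fin N → (∀ m, S m) → ℝ) (η : PolyProfile S) (n : Fin N) (τn : S n → ℝ) :
    Polynomial ℝ :=
  ∑ s : ∀ m, S m,
    (Polynomial.C (τn (s n)) * ∏ m ∈ Finset.univ.erase n, η m (s m)) * Polynomial.C (G n s)

/-- τn is a best reply of order r against the polynomial strategy profile η. -/
noncomputable def polyBestReply {S : Fin N → Type} [∀ n, Fintype (S n)] [∀ n, DecidableEq (S n)]
    (G : Fin N → (∀ m, S m) → ℝ) (η : PolyProfile S) (n : Fin N) (τn : S n → ℝ) (r : ℕ) : Prop :=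
  ∀ sn : S n,
    polyNonneg (payoffPoly G η n τn - payoffPoly G η n (pureStrat sn)) ∨
    ((r + 1 : ℕ) : ℕ∞) ≤ (payoffPoly G η n τn - payoffPoly G η n (pureStrat sn)).trailingDegree


theorem combine_eq_piSplitAt_symm {S : Fin N → Type} (n : Fin N) (sn : S n)
    (so : ∀ m : {m : Fin N // m ≠ n}, S m.val) :
    combine n sn so = (Equiv.piSplitAt n S).symm (sn, so) := by
  funext m
  by_cases h : m = n
  · subst h
    simp [combine]
  · simp [combine, h]

/-- Unilateral-deviation payoffs are payoffs against the product belief. -/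
theorem payoff_update_eq_beliefPayoff {S : Fin N → Type} [∀ n, Fintype (S n)]
    (G : Fin N → (∀ m, S m) → ℝ) (n : Fin N) (τ : Profile S) (τn : S n → ℝ) :
    payoff G n (Function.update τ n τn) =
      beliefPayoff G n τn (fun so => ∏ m : {m : Fin N // m ≠ n}, τ m.val (so m)) := by
  unfold payoff beliefPayoff
  rw [← (Equiv.piSplitAt n S).symm.sum_comp, Fintype.sum_prod_type, Finset.sum_comm]
  refine Finset.sum_congr rfl fun so _ => Finset.sum_congr rfl fun sn _ => ?_
  rw [← combine_eq_piSplitAt_symm]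
  congr 1
  rw [Fintype.prod_eq_mul_prod_subtype_ne _ n, mul_comm]
  congr 1
  · refine Finset.prod_congr rfl fun m _ => ?_
    rw [Function.update_of_ne m.2]
    simp [combine, m.2]
  · simp [combine]

theorem continuous_payoff_update {S : Fin N → Type} [∀ n, Fintype (S n)]
    (G : Fin N → (∀ m, S m) → ℝ) (n : Fin N) (τn : S n → ℝ) :
    Continuous fun τ : Profile S => payoff G n (Function.update τ n τn) := by
  simp only [payoff_update_eq_beliefPayoff, beliefPayoff]
  fun_prop

/-- With two players each player has exactly one opponent. -/
instance uniqueOpponent (n : Fin 2) : Unique {m : Fin 2 // m ≠ n} where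
  default := ⟨n + 1, by fin_cases n <;> decide⟩
  uniq := by
    rintro ⟨m, hm⟩
    apply Subtype.ext
    change m = n + 1
    revert m n
    decide

/-- With two players the payoff is affine in the opponent's strategy. -/
theorem payoff_update_combo {S : Fin 2 → Type} [∀ n, Fintype (S n)]
    (G : Fin 2 → (∀ m, S m) → ℝ) (n : Fin 2) (τn : S n → ℝ) (α β : Profile S) (a b : ℝ) :
    payoff G n (Function.update (a • α + b • β) n τn) =
      a * payoff G n (Function.update α n τn) + b * payoff G n (Function.update β n τn) := by
  simp only [payoff_update_eq_beliefPayoff, beliefPayoff, Fintype.prod_unique, Finset.mul_sum,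
    ← Finset.sum_add_distrib, Pi.add_apply, Pi.smul_apply, smul_eq_mul]
  refine Finset.sum_congr rfl fun so _ => Finset.sum_congr rfl fun sn _ => ?_
  ring

/-- With two players the induced belief is the opponent's corresponding LPS level. -/
theorem belief_two {S : Fin 2 → Type} [∀ n, Fintype (S n)] {K : ℕ}
    {ϱ : ∀ n, Fin (K + 1) → S n → ℝ} (hϱ : IsLPSProfile ϱ) (n : Fin 2) (k : Fin (K + 1)) :
    belief ϱ n k = fun so => ∏ m : {m : Fin 2 // m ≠ n}, ϱ m.val k (so m) := by
  have hu : ∀ so, ubelief ϱ n k so = ∏ m : {m : Fin 2 // m ≠ n}, ϱ m.val k (so m) := by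
    intro so
    unfold ubelief
    have hfilter : Finset.univ.filter
        (fun kv : {m : Fin 2 // m ≠ n} → Fin (K + 1) => (∑ m, ((kv m : ℕ))) = k) =
        {fun _ => k} := by
      ext kv
      simp only [Fintype.sum_unique, Finset.mem_filter, Finset.mem_univ, true_and,
        Finset.mem_singleton, Fin.val_inj]
      exact ⟨fun h => funext fun m => by rw [Unique.eq_default m, h], fun h => by rw [h]⟩
    rw [hfilter, Finset.sum_singleton]
  have hsum : ∑ so : ∀ m : {m : Fin 2 // m ≠ n}, S m.val,
      ∏ m : {m : Fin 2 // m ≠ n}, ϱ m.val k (so m) = 1 := by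
    have h := Finset.prod_univ_sum (fun m : {m : Fin 2 // m ≠ n} => (Finset.univ : Finset (S m.val)))
      (fun m s => ϱ m.val k s)
    rw [Fintype.piFinset_univ] at h
    rw [← h]
    exact Finset.prod_eq_one fun m _ => (hϱ m.val k).2
  funext so
  simp only [belief, hu, hsum, inv_one, one_mul]

theorem beliefPayoff_belief_two {S : Fin 2 → Type} [∀ n, Fintype (S n)] {K : ℕ}
    (G : Fin 2 → (∀ m, S m) → ℝ) {ϱ : ∀ n, Fin (K + 1) → S n → ℝ} (hϱ : IsLPSProfile ϱ)
    (n : Fin 2) (k : Fin (K + 1)) (τn : S n → ℝ) :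
    beliefPayoff G n τn (belief ϱ n k) =
      payoff G n (Function.update (fun m => ϱ m k) n τn) := by
  rw [belief_two hϱ, payoff_update_eq_beliefPayoff]

theorem lexGe_one_iff (a b : ℕ → ℝ) : lexGe 1 a b ↔ b 0 < a 0 ∨ a 0 = b 0 ∧ b 1 ≤ a 1 := by
  constructor
  · rintro (h | ⟨i, hi, hlt, h⟩)
    · exact Or.inr ⟨h 0 zero_le_one, (h 1 le_rfl).ge⟩
    · interval_cases i
      · exact Or.inl h
      · exact Or.inr ⟨hlt 0 one_pos, h.le⟩
  · rintro (h | ⟨h0, h1⟩)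
    · exact Or.inr ⟨0, zero_le_one, by simp, h⟩
    · rcases h1.eq_or_lt with h1 | h1
      · refine Or.inl fun i hi => ?_
        interval_cases i
        exacts [h0, h1.symm]
      · refine Or.inr ⟨1, le_rfl, fun j hj => ?_, h1⟩
        rwa [Nat.lt_one_iff.mp hj]

/-- For LPS profiles of order one, being a best reply means being lexicographically optimal
against the opponent's two levels. -/
theorem lpsBestReply_two_iff {S : Fin 2 → Type} [∀ n, Fintype (S n)] [∀ n, DecidableEq (S n)]
    (G : Fin 2 → (∀ m, S m) → ℝ) {ϱ : ∀ n, Fin (1 + 1) → S n → ℝ} (hϱ : IsLPSProfile ϱ)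
    (n : Fin 2) (τn : S n → ℝ) :
    lpsBestReply G ϱ n τn 1 ↔ ∀ sn : S n,
      payoff G n (Function.update (fun m => ϱ m 0) n (pureStrat sn)) <
        payoff G n (Function.update (fun m => ϱ m 0) n τn) ∨
      payoff G n (Function.update (fun m => ϱ m 0) n τn) =
        payoff G n (Function.update (fun m => ϱ m 0) n (pureStrat sn)) ∧
      payoff G n (Function.update (fun m => ϱ m 1) n (pureStrat sn)) ≤
        payoff G n (Function.update (fun m => ϱ m 1) n τn) := by
  simp only [← beliefPayoff_belief_two G hϱ]
  exact forall_congr' fun sn => lexGe_one_iff _ _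

theorem lpsLevel_le_of_fullSupport {S : Fin N → Type} [∀ n, Fintype (S n)] {K : ℕ}
    {ϱ : ∀ n, Fin (K + 1) → S n → ℝ} (h : FullSupport ϱ) : lpsLevel ϱ ≤ K := by
  refine Finset.sup_le fun n _ => Nat.sInf_le fun s => ?_
  obtain ⟨i, hi⟩ := h n s
  exact ⟨i, Nat.lt_succ_iff.mp i.2, hi⟩

/-- A lexicographic comparison is realized by all small enough perturbations. -/
theorem eventually_combo_le {a₀ a₁ b₀ b₁ : ℝ} (h : b₀ < a₀ ∨ a₀ = b₀ ∧ b₁ ≤ a₁) :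
    ∀ᶠ ε : ℝ in nhdsWithin 0 (Set.Ioi 0), (1 - ε) * b₀ + ε * b₁ ≤ (1 - ε) * a₀ + ε * a₁ := by
  rcases h with h | ⟨rfl, h⟩
  · have hc : Continuous fun ε : ℝ => ((1 - ε) * a₀ + ε * a₁) - ((1 - ε) * b₀ + ε * b₁) := by
      fun_prop
    have hev := (hc.tendsto 0).eventually (lt_mem_nhds (a := 0) (by simpa using h))
    filter_upwards [nhdsWithin_le_nhds hev] with ε hε
    linarith
  · filter_upwards [self_mem_nhdsWithin] with ε hε
    have := mul_le_mul_of_nonneg_left h (le_of_lt hε)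
    linarith

theorem exists_lps_of_isPerfect {S : Fin 2 → Type} [∀ n, Fintype (S n)]
    [∀ n, DecidableEq (S n)] {G : Fin 2 → (∀ m, S m) → ℝ} {σ : Profile S} (hσ : IsMixed σ)
    (h : IsPerfect G σ) :
    ∃ ϱ : ∀ n, Fin (1 + 1) → S n → ℝ, (IsLPSProfile ϱ ∧ FullSupport ϱ ∧ lpsLevel ϱ ≤ 1) ∧
      (∀ n, ϱ n 0 = σ n) ∧ (∀ n, lpsBestReply G ϱ n (σ n) 1) := by
  obtain ⟨σk, hmix, hlim, hbest⟩ := h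
  set ϱ : ∀ n, Fin (1 + 1) → S n → ℝ := fun n => ![σ n, σk 0 n]
  have hϱ : IsLPSProfile ϱ := fun n => Fin.forall_fin_two.2 ⟨hσ n, (hmix 0).1 n⟩
  have hfull : FullSupport ϱ := fun n s => ⟨1, ((hmix 0).2 n s).ne'⟩
  refine ⟨ϱ, ⟨hϱ, hfull, lpsLevel_le_of_fullSupport hfull⟩, fun n => rfl, fun n => ?_⟩
  rw [lpsBestReply_two_iff G hϱ]
  intro sn
  have h0 : payoff G n (Function.update σ n (pureStrat sn)) ≤
      payoff G n (Function.update σ n (σ n)) :=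
    le_of_tendsto_of_tendsto'
      (((continuous_payoff_update G n (pureStrat sn)).tendsto σ).comp hlim)
      (((continuous_payoff_update G n (σ n)).tendsto σ).comp hlim) fun k => hbest k n sn
  rcases h0.lt_or_eq with h0 | h0
  · exact Or.inl h0
  · exact Or.inr ⟨h0.symm, hbest 0 n sn⟩

theorem isPerfect_of_lps {S : Fin 2 → Type} [∀ n, Fintype (S n)]
    [∀ n, DecidableEq (S n)] {G : Fin 2 → (∀ m, S m) → ℝ} {σ : Profile S}
    {ϱ : ∀ n, Fin (1 + 1) → S n → ℝ} (hϱ : IsLPSProfile ϱ) (hfull : FullSupport ϱ)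
    (h0 : ∀ n, ϱ n 0 = σ n) (hbest : ∀ n, lpsBestReply G ϱ n (σ n) 1) : IsPerfect G σ := by
  have hev : ∀ᶠ ε : ℝ in nhdsWithin 0 (Set.Ioi 0), (0 < ε ∧ ε < 1) ∧ ∀ (n : Fin 2) (sn : S n),
      payoff G n (Function.update ((1 - ε) • (fun m => ϱ m 0) + ε • (fun m => ϱ m 1)) n
        (pureStrat sn)) ≤
      payoff G n (Function.update ((1 - ε) • (fun m => ϱ m 0) + ε • (fun m => ϱ m 1)) n
        (σ n)) := by
    simp only [payoff_update_combo]
    refine Filter.Eventually.and (Ioo_mem_nhdsGT one_pos) ?_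
    rw [Filter.eventually_all]
    intro n
    rw [Filter.eventually_all]
    exact fun sn => eventually_combo_le ((lpsBestReply_two_iff G hϱ n (σ n)).1 (hbest n) sn)
  obtain ⟨ε, hε, hεP⟩ := Filter.exists_seq_forall_of_frequently hev.frequently
  have hσ : σ = fun m => ϱ m 0 := (funext h0).symm
  refine ⟨fun k => (1 - ε k) • (fun m => ϱ m 0) + ε k • (fun m => ϱ m 1), fun k => ⟨?_, ?_⟩, ?_,
    fun k => (hεP k).2⟩
  · obtain ⟨hpos, hlt⟩ := (hεP k).1
    intro n
    refine ⟨fun s => add_nonneg (mul_nonneg (sub_pos.2 hlt).le ((hϱ n 0).1 s))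
      (mul_nonneg hpos.le ((hϱ n 1).1 s)), ?_⟩
    simp [Finset.sum_add_distrib, ← Finset.mul_sum, (hϱ n 0).2, (hϱ n 1).2]
  · obtain ⟨hpos, hlt⟩ := (hεP k).1
    intro n s
    have hlt' := sub_pos.2 hlt
    obtain ⟨i, hi⟩ := hfull n s
    have hi' := ((hϱ n i).1 s).lt_of_ne' hi
    change 0 < (1 - ε k) * ϱ n 0 s + ε k * ϱ n 1 s
    fin_cases i
    · exact add_pos_of_pos_of_nonneg (mul_pos hlt' hi') (mul_nonneg hpos.le ((hϱ n 1).1 s))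
    · exact add_pos_of_nonneg_of_pos (mul_nonneg hlt'.le ((hϱ n 0).1 s)) (mul_pos hpos hi')
  · have hc : Continuous fun t : ℝ =>
        ((1 - t) • (fun m => ϱ m 0) + t • (fun m => ϱ m 1) : Profile S) := by
      fun_prop
    have hlim := (hc.tendsto 0).comp (hε.mono_right nhdsWithin_le_nhds)
    simpa [hσ, Function.comp_def] using hlim

/-- for two-player games we can take ℓ = K = 1. -/
theorem stmt3 (S : Fin 2 → Type) [∀ n, Fintype (S n)]
    [∀ n, DecidableEq (S n)] [∀ n, Nonempty (S n)]
    (G : Fin 2 → (∀ m, S m) → ℝ)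
    (σ : Profile S) (hσ : IsMixed σ) :
    IsPerfect G σ ↔
      ∃ ϱ : ∀ n, Fin (1+1) → S n → ℝ,
        (IsLPSProfile ϱ ∧ FullSupport ϱ ∧ lpsLevel ϱ ≤ 1) ∧
        (∀ n, ϱ n 0 = σ n) ∧
        (∀ n, lpsBestReply G ϱ n (σ n) 1) := by
  constructor
  · exact exists_lps_of_isPerfect hσ
  · rintro ⟨ϱ, ⟨hϱ, hfull, -⟩, h0, hbest⟩
    exact isPerfect_of_lps hϱ hfull h0 hbest

end GamePE
end

section
/- Let G be a finite normal-form game with N ≥ 2 players, let ℓ ≤ K be non-negative integers, and let σ ∈ Σ. If there exists an LPS profile ϱ of order K over S such that ϱ has full support, ℓ(ϱ) ≤ ℓ, ϱ_n^0 = σ_n for each player n, and σ_n is a best reply of order K against ϱ for each n, then there exists a polynomial strategy-profile η : ℝ → ∏_n ℝ^{S_n} such that: (a) η_{n,s_n} > 0 for each n and s_n ∈ S_n, and o(η) ≤ ℓ (indeed o(η) can be taken equal to ℓ(ϱ)); (b) η(0) = σ; (c) σ_n is a best reply of order K against η for each player n. -/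
namespace GamePE

variable {N : ℕ}

/-- The polynomial strategy profile `η_n(t) = ∑ k, t ^ k • ϱ_n^k` generated by an LPS profile. -/
noncomputable def lpsPoly {S : Fin N → Type} {K : ℕ} (ϱ : ∀ n, Fin (K+1) → S n → ℝ) :
    PolyProfile S :=
  fun n s => ∑ k : Fin (K+1), Polynomial.monomial (k : ℕ) (ϱ n k s)

section

variable {S : Fin N → Type} {K : ℕ} (ϱ : ∀ n, Fin (K+1) → S n → ℝ)

theorem coeff_lpsPoly (n : Fin N) (s : S n) (i : Fin (K+1)) :
    (lpsPoly ϱ n s).coeff i = ϱ n i s := by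
  simp [lpsPoly, Polynomial.finsetSum_coeff, Polynomial.coeff_monomial, Fin.val_inj]

theorem coeff_lpsPoly_eq_zero (n : Fin N) (s : S n) {i : ℕ} (hi : K < i) :
    (lpsPoly ϱ n s).coeff i = 0 := by
  rw [lpsPoly, Polynomial.finsetSum_coeff]
  refine Finset.sum_eq_zero fun k _ => ?_
  rw [Polynomial.coeff_monomial, if_neg]
  have := k.isLt
  omega

theorem coeff_lpsPoly_ne_zero_iff (n : Fin N) (s : S n) (i : ℕ) :
    (lpsPoly ϱ n s).coeff i ≠ 0 ↔ ∃ k : Fin (K+1), (k : ℕ) = i ∧ ϱ n k s ≠ 0 := by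
  constructor
  · intro h
    have hi : i < K + 1 := by
      by_contra hi
      exact h (coeff_lpsPoly_eq_zero ϱ n s (by omega))
    exact ⟨⟨i, hi⟩, rfl, by rwa [← coeff_lpsPoly ϱ n s ⟨i, hi⟩]⟩
  · rintro ⟨k, rfl, hk⟩
    rwa [coeff_lpsPoly]

variable {ϱ}

theorem lpsPoly_ne_zero (hfs : FullSupport ϱ) (n : Fin N) (s : S n) : lpsPoly ϱ n s ≠ 0 := by
  obtain ⟨k, hk⟩ := hfs n s
  intro h
  rw [← coeff_lpsPoly ϱ n s k, h, Polynomial.coeff_zero] at hk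
  exact hk rfl

theorem polyPos_lpsPoly [∀ n, Fintype (S n)] (hϱ : IsLPSProfile ϱ) (hfs : FullSupport ϱ)
    (n : Fin N) (s : S n) : polyPos (lpsPoly ϱ n s) := by
  have h : (lpsPoly ϱ n s).trailingCoeff ≠ 0 :=
    Polynomial.trailingCoeff_nonzero_iff_nonzero.2 (lpsPoly_ne_zero hfs n s)
  refine lt_of_le_of_ne ?_ h.symm
  obtain ⟨k, hk, -⟩ := (coeff_lpsPoly_ne_zero_iff ϱ n s _).1 h
  rw [Polynomial.trailingCoeff, ← hk, coeff_lpsPoly]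
  exact (hϱ n k).1 s

theorem natTrailingDegree_lpsPoly_le_iff (hfs : FullSupport ϱ) (n : Fin N) (s : S n) (k : ℕ) :
    (lpsPoly ϱ n s).natTrailingDegree ≤ k ↔ ∃ i : Fin (K+1), (i : ℕ) ≤ k ∧ ϱ n i s ≠ 0 := by
  constructor
  · intro h
    have h' : (lpsPoly ϱ n s).trailingCoeff ≠ 0 :=
      Polynomial.trailingCoeff_nonzero_iff_nonzero.2 (lpsPoly_ne_zero hfs n s)
    obtain ⟨i, hi, hi'⟩ := (coeff_lpsPoly_ne_zero_iff ϱ n s _).1 h'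
    exact ⟨i, hi.trans_le h, hi'⟩
  · rintro ⟨i, hi, hi'⟩
    exact (Polynomial.natTrailingDegree_le_of_ne_zero (by rwa [coeff_lpsPoly])).trans hi

theorem polyOrder_lpsPoly [∀ n, Fintype (S n)] (hfs : FullSupport ϱ) :
    polyOrder (lpsPoly ϱ) = (lpsLevel ϱ : ℕ∞) := by
  refine eq_of_forall_ge_iff fun c => ?_
  induction c using ENat.recTopCoe with
  | top => simp
  | coe c =>
    rw [Nat.cast_le, polyOrder, lpsLevel, Finset.sup_le_iff, Finset.sup_le_iff, Sigma.forall]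
    simp only [Finset.mem_univ, forall_true_left]
    refine forall_congr' fun n => ?_
    simp_rw [Polynomial.trailingDegree_eq_natTrailingDegree (lpsPoly_ne_zero hfs n _),
      Nat.cast_le]
    simp_rw [natTrailingDegree_lpsPoly_le_iff hfs]
    refine ⟨fun h => Nat.sInf_le h, fun h s => ?_⟩
    have hmem := Nat.sInf_mem (s := {k : ℕ | ∀ s : S n, ∃ i : Fin (K+1), (i : ℕ) ≤ k ∧ ϱ n i s ≠ 0})
      ⟨K, fun s => (hfs n s).imp fun i hi => ⟨Nat.lt_succ_iff.1 i.isLt, hi⟩⟩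
    obtain ⟨i, hi, hi'⟩ := hmem s
    exact ⟨i, hi.trans h, hi'⟩

theorem coeff_prod_lpsPoly [∀ n, Fintype (S n)] (n : Fin N) (k : ℕ)
    (so : ∀ m : {m : Fin N // m ≠ n}, S m.val) :
    (∏ m : {m : Fin N // m ≠ n}, lpsPoly ϱ m.val (so m)).coeff k = ubelief ϱ n k so := by
  simp only [lpsPoly, Finset.prod_univ_sum, Fintype.piFinset_univ, Polynomial.finsetSum_coeff,
    ubelief, Finset.sum_filter]
  refine Finset.sum_congr rfl fun kv _ => ?_
  have : ∏ m : {m : Fin N // m ≠ n}, Polynomial.monomial (kv m : ℕ) (ϱ m.val (kv m) (so m)) =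
      Polynomial.monomial (∑ m, (kv m : ℕ)) (∏ m, ϱ m.val (kv m) (so m)) := by
    simp only [← Polynomial.C_mul_X_pow_eq_monomial, Finset.prod_mul_distrib,
      Finset.prod_pow_eq_pow_sum, map_prod]
  rw [this, Polynomial.coeff_monomial]

end

section

variable {S : Fin N → Type}

theorem combine_self (n : Fin N) (sn : S n) (so : ∀ m : {m : Fin N // m ≠ n}, S m.val) :
    combine n sn so n = sn := by
  simp [combine]

theorem combine_of_ne (n : Fin N) (sn : S n) (so : ∀ m : {m : Fin N // m ≠ n}, S m.val)
    (m : {m : Fin N // m ≠ n}) : combine n sn so m.val = so m := by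
  simp [combine, m.2]

theorem combine_restrict (n : Fin N) (s : ∀ m, S m) :
    combine n (s n) (fun m : {m : Fin N // m ≠ n} => s m.val) = s := by
  funext m
  by_cases h : m = n
  · subst h
    exact combine_self _ _ _
  · exact combine_of_ne n _ _ ⟨m, h⟩

variable [∀ n, Fintype (S n)]

theorem sum_eq_sum_combine (n : Fin N) (f : (∀ m, S m) → ℝ) :
    ∑ s, f s = ∑ so : ∀ m : {m : Fin N // m ≠ n}, S m.val, ∑ sn : S n, f (combine n sn so) := by
  rw [← Fintype.sum_prod_type' fun so sn => f (combine n sn so)]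
  let e : (∀ m, S m) ≃ (∀ m : {m : Fin N // m ≠ n}, S m.val) × S n :=
    { toFun := fun s => (fun m => s m.val, s n)
      invFun := fun p => combine n p.2 p.1
      left_inv := combine_restrict n
      right_inv := fun _ =>
        Prod.ext (funext fun m => combine_of_ne n _ _ m) (combine_self _ _ _) }
  exact Fintype.sum_equiv e _ _ fun s => congrArg f (combine_restrict n s).symm

variable (G : Fin N → (∀ m, S m) → ℝ) {K : ℕ} (ϱ : ∀ n, Fin (K+1) → S n → ℝ)

theorem coeff_payoffPoly_lpsPoly (n : Fin N) (τn : S n → ℝ) (k : ℕ) :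
    (payoffPoly G (lpsPoly ϱ) n τn).coeff k = beliefPayoff G n τn (ubelief ϱ n k) := by
  simp only [payoffPoly, Polynomial.finsetSum_coeff, Polynomial.coeff_mul_C,
    Polynomial.coeff_C_mul]
  rw [sum_eq_sum_combine n, beliefPayoff]
  refine Finset.sum_congr rfl fun so _ => Finset.sum_congr rfl fun sn _ => ?_
  rw [combine_self, Finset.prod_subtype (p := fun m => m ≠ n) _ (by simp)]
  simp_rw [combine_of_ne]
  rw [coeff_prod_lpsPoly]
  ring

theorem beliefPayoff_belief (n : Fin N) (τn : S n → ℝ) (k : ℕ) :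
    beliefPayoff G n τn (belief ϱ n k) =
      (∑ so, ubelief ϱ n k so)⁻¹ * beliefPayoff G n τn (ubelief ϱ n k) := by
  simp only [beliefPayoff, belief, Finset.mul_sum, mul_assoc]

variable {ϱ}

theorem sum_ubelief_pos (hN : 2 ≤ N) (hϱ : IsLPSProfile ϱ) (n : Fin N) {k : ℕ} (hk : k ≤ K) :
    0 < ∑ so, ubelief ϱ n k so := by
  simp only [ubelief]
  rw [Finset.sum_comm]
  have hprod : ∀ kv : {m : Fin N // m ≠ n} → Fin (K+1),
      ∑ so : ∀ m : {m : Fin N // m ≠ n}, S m.val,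
        ∏ m : {m : Fin N // m ≠ n}, ϱ m.val (kv m) (so m) = 1 := by
    intro kv
    rw [← Fintype.prod_sum fun (m : {m : Fin N // m ≠ n}) s => ϱ m.val (kv m) s]
    exact Finset.prod_eq_one fun m _ => (hϱ m.val (kv m)).2
  simp_rw [hprod]
  have : Nontrivial (Fin N) := Fin.nontrivial_iff_two_le.2 hN
  obtain ⟨m, hm⟩ := exists_ne n
  refine Finset.sum_pos (fun _ _ => one_pos) ⟨Pi.single ⟨m, hm⟩ ⟨k, Nat.lt_succ_of_le hk⟩, ?_⟩
  simp only [Finset.mem_filter, Finset.mem_univ, true_and]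
  rw [Finset.sum_eq_single ⟨m, hm⟩]
  · simp
  · intro b _ hb
    simp [Pi.single_eq_of_ne hb]
  · simp

end

/-- A polynomial whose coefficients, up to positive factors, are lexicographically nonnegative up
to index `r` is nonnegative or has order greater than `r`. -/
theorem polyNonneg_or_le_trailingDegree {f : Polynomial ℝ} {r : ℕ} {a b : ℕ → ℝ}
    (hab : lexGe r a b) (hf : ∀ i ≤ r, ∃ c > 0, f.coeff i = c * (a i - b i)) :
    polyNonneg f ∨ ((r + 1 : ℕ) : ℕ∞) ≤ f.trailingDegree := by
  have hz : ∀ i ≤ r, a i = b i → f.coeff i = 0 := by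
    intro i hi h
    obtain ⟨c, -, hc⟩ := hf i hi
    rw [hc, h, sub_self, mul_zero]
  rcases hab with h | ⟨i, hi, heq, hlt⟩
  · refine Or.inr (Finset.le_min fun j hj => ?_)
    refine Nat.cast_le.2 ?_
    by_contra hj'
    have hjr : j ≤ r := by omega
    exact Polynomial.mem_support_iff.1 hj (hz j hjr (h j hjr))
  · refine Or.inl (Or.inr ?_)
    obtain ⟨c, hc, hci⟩ := hf i hi
    have hpos : 0 < f.coeff i := hci ▸ mul_pos hc (sub_pos.2 hlt)
    have hdeg : f.natTrailingDegree = i := by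
      refine le_antisymm (Polynomial.natTrailingDegree_le_of_ne_zero hpos.ne') ?_
      by_contra hlt'
      rw [not_le] at hlt'
      have hf0 : f ≠ 0 := by
        rintro rfl
        simp at hpos
      exact Polynomial.trailingCoeff_nonzero_iff_nonzero.2 hf0
        (hz _ (hlt'.le.trans hi) (heq _ hlt'))
    rwa [Polynomial.trailingCoeff, hdeg]

/-- from an LPS profile to a polynomial strategy-profile. -/
theorem stmt4 {N : ℕ} (hN : 2 ≤ N) (S : Fin N → Type) [∀ n, Fintype (S n)]
    [∀ n, DecidableEq (S n)] [∀ n, Nonempty (S n)]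
    (G : Fin N → (∀ m, S m) → ℝ) (ℓ K : ℕ) (hℓK : ℓ ≤ K)
    (σ : Profile S) (hσ : IsMixed σ)
    (ϱ : ∀ n, Fin (K+1) → S n → ℝ) (hϱ : IsLPSProfile ϱ) (hfs : FullSupport ϱ)
    (hlev : lpsLevel ϱ ≤ ℓ) (h0 : ∀ n, ϱ n 0 = σ n)
    (hbr : ∀ n, lpsBestReply G ϱ n (σ n) K) :
    ∃ η : PolyProfile S,
      (∀ n (sn : S n), polyPos (η n sn)) ∧
      polyOrder η = (lpsLevel ϱ : ℕ∞) ∧ polyOrder η ≤ (ℓ : ℕ∞) ∧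
      (∀ n (sn : S n), (η n sn).eval 0 = σ n sn) ∧
      (∀ n, polyBestReply G η n (σ n) K) := by
  refine ⟨lpsPoly ϱ, polyPos_lpsPoly hϱ hfs, polyOrder_lpsPoly hfs, ?_, fun n sn => ?_,
    fun n sn => ?_⟩
  · rw [polyOrder_lpsPoly hfs]
    exact Nat.cast_le.2 hlev
  · rw [← Polynomial.coeff_zero_eq_eval_zero, ← h0 n]
    exact coeff_lpsPoly ϱ n sn 0
  · refine polyNonneg_or_le_trailingDegree (hbr n sn) fun i hi => ?_
    have hpos := sum_ubelief_pos hN hϱ n hi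
    refine ⟨_, hpos, ?_⟩
    rw [beliefPayoff_belief, beliefPayoff_belief, ← mul_sub, mul_inv_cancel_left₀ hpos.ne',
      Polynomial.coeff_sub, coeff_payoffPoly_lpsPoly, coeff_payoffPoly_lpsPoly]

end GamePE
end
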